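/- Let F and G be proper filters in S. If F ∩ G ≠ ∅ and d(F) = d(G), then F = G. -/

import Mathlib

/-- An inverse semigroup with zero: every element `a` has a unique `a⁻¹` with
`a * a⁻¹ * a = a` and `a⁻¹ * a * a⁻¹ = a⁻¹`, and `0` is absorbing. -/
class InvSemigroupWithZero (S : Type*) extends Semigroup S, Zero S, Inv S where
  mul_inv_mul : ∀ a : S, a * a⁻¹ * a = a
  inv_mul_inv : ∀ a : S, a⁻¹ * a * a⁻¹ = a⁻¹
  inv_unique : ∀ a b : S, a * b * a = a → b * a * b = b → b = a⁻¹
  zero_mul : ∀ a : S, 0 * a = 0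
  mul_zero : ∀ a : S, a * 0 = 0

namespace InvSemigroupWithZero

variable {S : Type*} [InvSemigroupWithZero S]

/-- The natural partial order on `S`: `a ≤ b` iff `a = a * a⁻¹ * b`. -/
def sle (a b : S) : Prop := a = a * a⁻¹ * b

/-- `↓s`, the down-set of `s` w.r.t. the natural partial order. -/
def dwn (s : S) : Set S := {t : S | sle t s}

/-- `↑A`, the up-set generated by `A` w.r.t. the natural partial order. -/
def up (A : Set S) : Set S := {b : S | ∃ a ∈ A, sle a b}

/-- A filter in `S`: a nonempty down-directed up-set. -/
def IsFilt (F : Set S) : Prop :=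
  F.Nonempty ∧ up F = F ∧ ∀ a ∈ F, ∀ b ∈ F, ∃ c ∈ F, sle c a ∧ sle c b

/-- A proper filter: a filter not containing `0`. -/
def IsPFilt (F : Set S) : Prop := IsFilt F ∧ (0 : S) ∉ F

/-- An ultrafilter: a proper filter maximal among proper filters. -/
def IsUltra (U : Set S) : Prop :=
  IsPFilt U ∧ ∀ G : Set S, IsPFilt G → U ⊆ G → U = G

/-- The set `E` of idempotents of `S`. -/
def E (S : Type*) [InvSemigroupWithZero S] : Set S := {e : S | e * e = e}

/-- `F⁻¹ = {a⁻¹ : a ∈ F}`. -/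
def finv (F : Set S) : Set S := (fun a : S => a⁻¹) '' F

/-- `F · G = ↑{fg : f ∈ F, g ∈ G}`. -/
def fmul (F G : Set S) : Set S := up (Set.image2 (· * ·) F G)

/-- The source `d(F) := F⁻¹ · F`. -/
def src (F : Set S) : Set S := fmul (finv F) F

/-- The range `r(F) := F · F⁻¹`. -/
def rng (F : Set S) : Set S := fmul F (finv F)

/-- The natural partial order on the idempotents: `e ≤ f` iff `e = e * f`. -/
def ele (e f : S) : Prop := e = e * f

/-- The down-set of an idempotent `e` inside `E`. -/
def edwn (e : S) : Set S := {f : S | f ∈ E S ∧ ele f e}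

/-- The up-set generated by `A` inside `E`. -/
def eup (A : Set S) : Set S := {f : S | f ∈ E S ∧ ∃ a ∈ A, ele a f}

/-- An `E`-filter: a proper filter of the inverse semigroup `E` of idempotents. -/
def IsEFilt (ξ : Set S) : Prop :=
  ξ ⊆ E S ∧ ξ.Nonempty ∧ eup ξ = ξ ∧
    (∀ a ∈ ξ, ∀ b ∈ ξ, ∃ c ∈ ξ, ele c a ∧ ele c b) ∧ (0 : S) ∉ ξ

/-- An `E`-ultrafilter: an `E`-filter maximal among `E`-filters. -/
def IsEUltra (ξ : Set S) : Prop :=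
  IsEFilt ξ ∧ ∀ η : Set S, IsEFilt η → ξ ⊆ η → ξ = η

/-- `β_s(ξ) = {f ∈ E : s·e·s⁻¹ ≤ f for some e ∈ ξ}`. -/
def beta (s : S) (ξ : Set S) : Set S :=
  {f : S | f ∈ E S ∧ ∃ e ∈ ξ, sle (s * e * s⁻¹) f}

/-- The set of proper filters in `S`. -/
abbrev PFilt (S : Type*) [InvSemigroupWithZero S] := {F : Set S // IsPFilt F}

/-- The patch topology on the set of proper filters, generated by the sets
`F(s;T) = {F : s ∈ F, F ∩ T = ∅}` for `s ∈ S` and finite `T ⊆ ↓s`. -/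
instance patchTopology : TopologicalSpace (PFilt S) :=
  TopologicalSpace.generateFrom
    {O : Set (PFilt S) | ∃ (s : S) (T : Set S), T.Finite ∧ T ⊆ dwn s ∧
      O = {F : PFilt S | s ∈ F.1 ∧ F.1 ∩ T = ∅}}

/-- The set of idempotent proper filters in `S`. -/
abbrev IPFilt (S : Type*) [InvSemigroupWithZero S] :=
  {F : Set S // IsPFilt F ∧ (F ∩ E S).Nonempty}

/-- The subspace topology induced by the patch topology on proper filters. -/
instance : TopologicalSpace (IPFilt S) :=
  TopologicalSpace.induced (fun F => (⟨F.1, F.2.1⟩ : PFilt S)) inferInstance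

/-- The set of `E`-filters. -/
abbrev EFilt (S : Type*) [InvSemigroupWithZero S] := {ξ : Set S // IsEFilt ξ}

/-- The patch topology on the set of `E`-filters, generated by the sets
`P(e;X) = {ξ : e ∈ ξ, ξ ∩ X = ∅}` for `e ∈ E` and finite `X ⊆ ↓e ∩ E`. -/
instance : TopologicalSpace (EFilt S) :=
  TopologicalSpace.generateFrom
    {O : Set (EFilt S) | ∃ (e : S) (X : Set S), e ∈ E S ∧ X.Finite ∧ X ⊆ edwn e ∧
      O = {ξ : EFilt S | e ∈ ξ.1 ∧ ξ.1 ∩ X = ∅}}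

/-- The set of ultrafilters in `S`. -/
abbrev UFilt (S : Type*) [InvSemigroupWithZero S] := {U : Set S // IsUltra U}

/-- The subspace topology induced by the patch topology on proper filters. -/
instance : TopologicalSpace (UFilt S) :=
  TopologicalSpace.induced (fun U => (⟨U.1, U.2.1⟩ : PFilt S)) inferInstance

end InvSemigroupWithZero

open InvSemigroupWithZero

namespace InvSemigroupWithZero

variable {S : Type*} [InvSemigroupWithZero S]

lemma eq_inv_of_idem {e : S} (he : e * e = e) : e = e⁻¹ :=
  inv_unique e e (by rw [he, he]) (by rw [he, he])

lemma idem_mul {e f : S} (he : e * e = e) (hf : f * f = f) : (e * f) * (e * f) = e * f := by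
  have h1 := mul_inv_mul (e * f)
  have h2 := inv_mul_inv (e * f)
  set x := (e * f)⁻¹
  have hfxe : f * x * e = x := by
    refine inv_unique (e * f) _ ?_ ?_
    · calc e * f * (f * x * e) * (e * f) = e * (f * f) * x * ((e * e) * f) := by
            simp only [mul_assoc]
        _ = e * f := by rw [he, hf, h1]
    · calc f * x * e * (e * f) * (f * x * e) = f * (x * ((e * e) * (f * f)) * x) * e := by
            simp only [mul_assoc]
        _ = f * x * e := by rw [he, hf, h2]
  have hxx : x * x = x := by
    calc x * x = (f * x * e) * (f * x * e) := by rw [hfxe]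
      _ = f * (x * (e * f) * x) * e := by simp only [mul_assoc]
      _ = x := by rw [h2, hfxe]
  have hef : e * f = x := (inv_unique x (e * f) h2 h1).trans (eq_inv_of_idem hxx).symm
  rw [hef, hxx]

lemma idem_comm {e f : S} (he : e * e = e) (hf : f * f = f) : e * f = f * e := by
  have key : ∀ {e f : S}, e * e = e → f * f = f → e * f * (f * e) * (e * f) = e * f := by
    intro e f he hf
    calc e * f * (f * e) * (e * f) = e * (f * f) * ((e * e) * f) := by simp only [mul_assoc]
      _ = e * f := by rw [he, hf, idem_mul he hf]
  exact (eq_inv_of_idem (idem_mul he hf)).trans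
    (inv_unique (e * f) (f * e) (key he hf) (key hf he)).symm

lemma idem_mul_inv (a : S) : (a * a⁻¹) * (a * a⁻¹) = a * a⁻¹ := by
  rw [← mul_assoc, mul_inv_mul]

lemma idem_inv_mul (a : S) : (a⁻¹ * a) * (a⁻¹ * a) = a⁻¹ * a := by
  rw [← mul_assoc, inv_mul_inv]

lemma inv_mul_rev (a b : S) : (a * b)⁻¹ = b⁻¹ * a⁻¹ := by
  refine (inv_unique _ _ ?_ ?_).symm
  · calc a * b * (b⁻¹ * a⁻¹) * (a * b) = a * ((b * b⁻¹) * (a⁻¹ * a)) * b := by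
          simp only [mul_assoc]
      _ = a * ((a⁻¹ * a) * (b * b⁻¹)) * b := by
          rw [idem_comm (idem_mul_inv b) (idem_inv_mul a)]
      _ = (a * a⁻¹ * a) * (b * b⁻¹ * b) := by simp only [mul_assoc]
      _ = a * b := by rw [mul_inv_mul, mul_inv_mul]
  · calc b⁻¹ * a⁻¹ * (a * b) * (b⁻¹ * a⁻¹) = b⁻¹ * ((a⁻¹ * a) * (b * b⁻¹)) * a⁻¹ := by
          simp only [mul_assoc]
      _ = b⁻¹ * ((b * b⁻¹) * (a⁻¹ * a)) * a⁻¹ := by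
          rw [idem_comm (idem_mul_inv b) (idem_inv_mul a)]
      _ = (b⁻¹ * b * b⁻¹) * (a⁻¹ * a * a⁻¹) := by simp only [mul_assoc]
      _ = b⁻¹ * a⁻¹ := by rw [inv_mul_inv, inv_mul_inv]

lemma sle_refl (a : S) : sle a a := (mul_inv_mul a).symm

lemma sle_of_eq_idem_mul {a b e : S} (he : e * e = e) (h : a = e * b) : sle a b := by
  subst h
  refine Eq.symm ?_
  calc e * b * (e * b)⁻¹ * b = e * ((b * b⁻¹) * e) * b := by
        rw [inv_mul_rev, ← eq_inv_of_idem he]; simp only [mul_assoc]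
    _ = (e * e) * (b * b⁻¹ * b) := by
        rw [idem_comm (idem_mul_inv b) he]; simp only [mul_assoc]
    _ = e * b := by rw [he, mul_inv_mul]

lemma sle_of_eq_mul_idem {a b e : S} (he : e * e = e) (h : a = b * e) : sle a b := by
  subst h
  refine Eq.symm ?_
  calc b * e * (b * e)⁻¹ * b = b * (e * e) * (b⁻¹ * b) := by
        rw [inv_mul_rev, ← eq_inv_of_idem he]; simp only [mul_assoc]
    _ = b * (e * (b⁻¹ * b)) := by rw [he, mul_assoc]
    _ = b * b⁻¹ * b * e := by
        rw [idem_comm he (idem_inv_mul b)]; simp only [mul_assoc]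
    _ = b * e := by rw [mul_inv_mul]

lemma sle.eq_mul_inv_mul {a b : S} (h : sle a b) : a = b * (a⁻¹ * a) := by
  have he := idem_mul_inv a
  have h' : a = a * a⁻¹ * b := h
  set e := a * a⁻¹
  symm
  calc b * (a⁻¹ * a) = b * ((e * b)⁻¹ * (e * b)) := by rw [← h']
    _ = (b * b⁻¹) * (e * e) * b := by
        rw [inv_mul_rev, ← eq_inv_of_idem he]; simp only [mul_assoc]
    _ = e * (b * b⁻¹ * b) := by
        rw [he, idem_comm (idem_mul_inv b) he]; simp only [mul_assoc]
    _ = a := by rw [mul_inv_mul, ← h']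

lemma sle.trans {a b c : S} (hab : sle a b) (hbc : sle b c) : sle a c := by
  refine sle_of_eq_idem_mul (idem_mul (idem_mul_inv a) (idem_mul_inv b)) ?_
  rw [mul_assoc, ← show b = b * b⁻¹ * c from hbc]
  exact hab

/-- An element below an idempotent is absorbed by it on the right. -/
lemma sle.mul_idem {a e : S} (h : sle a e) (he : e * e = e) : a * e = a := by
  have h' : a = a * a⁻¹ * e := h
  calc a * e = a * a⁻¹ * (e * e) := by rw [← mul_assoc, ← h']
    _ = a := by rw [he, ← h']

lemma sle.inv_mul_absorb {z x y e : S} (hzx : sle z x) (hzy : sle z y)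
    (h : sle (x⁻¹ * y) e) (he : e * e = e) : z⁻¹ * z * e = z⁻¹ * z := by
  have hp := idem_inv_mul z
  have hx := hzx.eq_mul_inv_mul
  have hy := hzy.eq_mul_inv_mul
  set p := z⁻¹ * z
  have hz : p = p * (x⁻¹ * y) * p := by
    calc p = (x * p)⁻¹ * (y * p) := by rw [← hx, ← hy]
      _ = p * (x⁻¹ * y) * p := by
        rw [inv_mul_rev, ← eq_inv_of_idem hp]; simp only [mul_assoc]
  calc p * e = p * (x⁻¹ * y) * p * e := by rw [← hz]
    _ = p * (x⁻¹ * y * e) * p := by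
        rw [mul_assoc _ p e, idem_comm hp he]; simp only [mul_assoc]
    _ = p := by rw [h.mul_idem he, ← hz]

lemma IsFilt.mem_of_sle {F : Set S} (hF : IsFilt F) {a b : S} (ha : a ∈ F) (h : sle a b) :
    b ∈ F :=
  hF.2.1 ▸ ⟨a, ha, h⟩

lemma IsFilt.subset_of_src_subset {F G : Set S} (hF : IsFilt F) (hG : IsFilt G)
    (hFG : (F ∩ G).Nonempty) (hd : src F ⊆ src G) : F ⊆ G := by
  obtain ⟨c, hcF, hcG⟩ := hFG
  intro a ha
  obtain ⟨b, hbF, hba, hbc⟩ := hF.2.2 a ha c hcF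
  have hb : b⁻¹ * b ∈ src F := ⟨b⁻¹ * b, ⟨b⁻¹, ⟨b, hbF, rfl⟩, b, hbF, rfl⟩, sle_refl _⟩
  obtain ⟨_, ⟨_, ⟨x, hx, rfl⟩, y, hy, rfl⟩, hxy⟩ := hd hb
  obtain ⟨w, hw, hwx, hwy⟩ := hG.2.2 x hx y hy
  obtain ⟨z, hz, hzw, hzc⟩ := hG.2.2 w hw c hcG
  have hzb : z⁻¹ * z * (b⁻¹ * b) = z⁻¹ * z :=
    (hzw.trans hwx).inv_mul_absorb (hzw.trans hwy) hxy (idem_inv_mul b)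
  refine hG.mem_of_sle hz (sle.trans (sle_of_eq_mul_idem (idem_inv_mul z) ?_) hba)
  calc z = c * (z⁻¹ * z) := hzc.eq_mul_inv_mul
    _ = c * (b⁻¹ * b) * (z⁻¹ * z) := by
        rw [mul_assoc, idem_comm (idem_inv_mul b) (idem_inv_mul z), hzb]
    _ = b * (z⁻¹ * z) := by rw [← hbc.eq_mul_inv_mul]

end InvSemigroupWithZero

/-- If `F, G` are proper filters with `F ∩ G ≠ ∅` and `d(F) = d(G)`, then
`F = G`. -/
theorem stmt_6 {S : Type*} [InvSemigroupWithZero S]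
    (F G : Set S) (hF : IsPFilt F) (hG : IsPFilt G)
    (hFG : (F ∩ G).Nonempty) (hd : src F = src G) : F = G :=
  (hF.1.subset_of_src_subset hG.1 hFG hd.subset).antisymm
    (hG.1.subset_of_src_subset hF.1 (Set.inter_comm F G ▸ hFG) hd.superset)
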